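/- There is no regular language L over the symmetric alphabet X = {x^{±1}, y^{±1}, t^{±1}, s^{±1}} such that every word of L is geodesic for G and the evaluation map from L to G is surjective. -/

import Mathlib

/-! Generators and presentations for the groups `H` and `G` of Neumann–Shapiro. -/

inductive GenH : Type
  | x | y | t | tau
  deriving DecidableEq

inductive GenG : Type
  | x | y | s | t
  deriving DecidableEq

namespace NS

open FreeGroup

/-- Conjugation `a^b = b⁻¹ a b` in a group. -/
def cnj {Γ : Type*} [Group Γ] (a b : Γ) : Γ := b⁻¹ * a * b

/-! ### The group `H` -/

abbrev FH := FreeGroup GenH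

def fx : FH := FreeGroup.of GenH.x
def fy : FH := FreeGroup.of GenH.y
def ft : FH := FreeGroup.of GenH.t
def ftau : FH := FreeGroup.of GenH.tau

/-- The eight elements `x, x^t, x^τ, x^{tτ}, y, y^t, y^τ, y^{tτ}` (as words). -/
def basisH : List FH :=
  [fx, cnj fx ft, cnj fx ftau, cnj fx (ft * ftau),
   fy, cnj fy ft, cnj fy ftau, cnj fy (ft * ftau)]

/-- Relators of `H`: `t² = τ² = [τ,t] = 1`, the eight elements of `basisH` pairwise
commute, and `x · x^τ = y · y^t`. -/
def relsH : Set FH :=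
  {ft ^ 2, ftau ^ 2, ftau⁻¹ * ft⁻¹ * ftau * ft} ∪
    {r | ∃ a ∈ basisH, ∃ b ∈ basisH, r = a * b * a⁻¹ * b⁻¹} ∪
    {fx * cnj fx ftau * (fy * cnj fy ft)⁻¹}

abbrev H := PresentedGroup relsH

def Hx : H := PresentedGroup.of GenH.x
def Hy : H := PresentedGroup.of GenH.y
def Ht : H := PresentedGroup.of GenH.t
def Htau : H := PresentedGroup.of GenH.tau

/-! ### The group `G` -/

abbrev FG := FreeGroup GenG

def gx : FG := FreeGroup.of GenG.x
def gy : FG := FreeGroup.of GenG.y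
def gs : FG := FreeGroup.of GenG.s
def gt : FG := FreeGroup.of GenG.t

/-- The eight conjugating elements `1, s, s², s³, t, ts, ts², ts³`. -/
def conjsG : List FG := [1, gs, gs ^ 2, gs ^ 3, gt, gt * gs, gt * gs ^ 2, gt * gs ^ 3]

/-- The sixteen elements `x^α, y^α` for `α ∈ {1, s, s², s³, t, ts, ts², ts³}`. -/
def basisG : List FG :=
  conjsG.map (fun b => cnj gx b) ++ conjsG.map (fun b => cnj gy b)

/-- Relators of `G`: `t² = s⁴ = [s,t] = 1`, the sixteen elements of `basisG` pairwise
commute, and `x · x^{s²} = y · y^t`. -/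
def relsG : Set FG :=
  {gt ^ 2, gs ^ 4, gs⁻¹ * gt⁻¹ * gs * gt} ∪
    {r | ∃ a ∈ basisG, ∃ b ∈ basisG, r = a * b * a⁻¹ * b⁻¹} ∪
    {gx * cnj gx (gs ^ 2) * (gy * cnj gy gt)⁻¹}

abbrev G := PresentedGroup relsG

def Gx : G := PresentedGroup.of GenG.x
def Gy : G := PresentedGroup.of GenG.y
def Gs : G := PresentedGroup.of GenG.s
def Gt : G := PresentedGroup.of GenG.t

/-! ### Words, evaluation, lengths, geodesics -/

/-- A word over the symmetric alphabet on `α`: a letter `(a, true)` stands for the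
generator `a` and `(a, false)` for its inverse. -/
abbrev Word (α : Type) := List (α × Bool)

/-- Evaluate a word in a group, given the images of the generators. -/
def evalWith {α : Type} {Γ : Type*} [Group Γ] (f : α → Γ) (w : Word α) : Γ :=
  (w.map fun p => if p.2 then f p.1 else (f p.1)⁻¹).prod

/-- Evaluation of a word over `X_H = {x^{±1}, y^{±1}, t^{±1}, τ^{±1}}` in `H`. -/
def evalH : Word GenH → H := evalWith (fun a => (PresentedGroup.of a : H))

/-- Evaluation of a word over `X = {x^{±1}, y^{±1}, t^{±1}, s^{±1}}` in `G`. -/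
def evalG : Word GenG → G := evalWith (fun a => (PresentedGroup.of a : G))

/-- Weight of a letter for `H`: the letters `x^{±1}, y^{±1}, t^{±1}` have length `1`
and `τ^{±1}` has length `2`. -/
def wtH : GenH × Bool → ℕ
  | (GenH.tau, _) => 2
  | _ => 1

/-- Weighted length of a word over `X_H`. -/
def wlenH (w : Word GenH) : ℕ := (w.map wtH).sum

/-- `ℓ(h)`: the minimum weighted length of a word over `X_H` evaluating to `h`. -/
noncomputable def ellH (h : H) : ℕ := sInf {n | ∃ w : Word GenH, evalH w = h ∧ wlenH w = n}

/-- A word over `X_H` is geodesic if its weighted length is `ℓ` of its evaluation. -/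
def IsGeodesicH (w : Word GenH) : Prop := wlenH w = ellH (evalH w)

/-- `ℓ_G(g)`: the minimum length (number of letters) of a word over `X` evaluating to `g`. -/
noncomputable def ellG (g : G) : ℕ := sInf {n | ∃ w : Word GenG, evalG w = g ∧ w.length = n}

/-- A word over `X` is geodesic if its length is `ℓ_G` of its evaluation. -/
def IsGeodesicG (w : Word GenG) : Prop := w.length = ellG (evalG w)

end NS

namespace NS

/-- The quotient of `G` by its abelian normal subgroup: the states traversed by a word. -/
abbrev St := ZMod 4 × ZMod 2

/-- Image of a generator in the state group. -/
def mv : GenG → St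
  | GenG.s => (1, 0)
  | GenG.t => (0, 1)
  | _ => 0

/-- Exponent of a letter. -/
def sg (b : Bool) : ℤ := if b then 1 else -1

/-- State reached after reading a word from right to left. -/
def st : Word GenG → St
  | [] => 0
  | a :: w => st w + sg a.2 • mv a.1

/-- Sum of the contributions `f a σ` of the letters `a` of a word, where `σ` is the state in
which the letter is read. -/
def tot (f : GenG × Bool → St → ℤ) : Word GenG → ℤ
  | [] => 0
  | a :: w => f a (st w) + tot f w

/-- Every letter of a word satisfies `P` in the state in which it is read. -/
def AllAt (P : GenG × Bool → St → Prop) : Word GenG → Prop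
  | [] => True
  | a :: w => P a (st w) ∧ AllAt P w

/-- Whether the state `σ` is visited by a word. -/
def vis (σ : St) : Word GenG → Bool
  | [] => decide ((0 : St) = σ)
  | a :: w => vis σ w || decide (st (a :: w) = σ)

/-- Whether a letter changes the state. -/
def isMove : GenG → Bool
  | GenG.s => true
  | GenG.t => true
  | _ => false

/-- Signed contribution of a letter, given the contributions of the generators. -/
def signed (f : GenG → St → ℤ) (a : GenG × Bool) (σ : St) : ℤ := sg a.2 * f a.1 σ

/-! ### Invariants of group elements -/

/-- The permutation of `St × ℤ` induced by a generator. -/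
def genPerm (f : GenG → St → ℤ) (g : GenG) : Equiv.Perm (St × ℤ) where
  toFun p := (p.1 + mv g, p.2 + f g p.1)
  invFun p := (p.1 - mv g, p.2 - f g (p.1 - mv g))
  left_inv p := by simp
  right_inv p := by simp

/-- Fibrewise translation of `St × ℤ`. -/
def fibTrans (h : St → ℤ) : Equiv.Perm (St × ℤ) where
  toFun p := (p.1, p.2 + h p.1)
  invFun p := (p.1, p.2 - h p.1)
  left_inv p := by simp
  right_inv p := by simp

/-- Translation of the base of `St × ℤ`. -/
def baseShift (d : St) : Equiv.Perm (St × ℤ) where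
  toFun p := (p.1 + d, p.2)
  invFun p := (p.1 - d, p.2)
  left_inv p := by simp
  right_inv p := by simp

lemma fibTrans_commute (h k : St → ℤ) : fibTrans h * fibTrans k = fibTrans k * fibTrans h := by
  ext p <;> simp [fibTrans, add_right_comm]

lemma fibTrans_mul (h k : St → ℤ) : fibTrans h * fibTrans k = fibTrans (fun σ => h σ + k σ) := by
  ext p <;> simp [fibTrans, add_comm, add_left_comm]

lemma baseShift_mul (d e : St) : baseShift d * baseShift e = baseShift (d + e) := by
  ext p <;> simp [baseShift, add_comm, add_left_comm]

lemma baseShift_zero : baseShift 0 = 1 := by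
  ext p <;> simp [baseShift]

lemma baseShift_pow (d : St) (n : ℕ) : baseShift d ^ n = baseShift (n • d) := by
  induction n with
  | zero => simp [baseShift_zero]
  | succ n ih => rw [pow_succ, ih, baseShift_mul, succ_nsmul]

lemma baseShift_inv (d : St) : (baseShift d)⁻¹ = baseShift (-d) := by
  rw [inv_eq_iff_mul_eq_one, baseShift_mul, add_neg_cancel, baseShift_zero]

lemma cnj_fibTrans (h : St → ℤ) (d : St) :
    cnj (fibTrans h) (baseShift d) = fibTrans (fun σ => h (σ + d)) := by
  rw [cnj, baseShift_inv]
  ext p <;> simp [fibTrans, baseShift]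

/-- Contributions of generators compatible with the relators of `G`. -/
structure Compatible (f : GenG → St → ℤ) : Prop where
  s_zero : ∀ σ, f GenG.s σ = 0
  t_zero : ∀ σ, f GenG.t σ = 0
  rel : ∀ σ, f GenG.x σ + f GenG.x (σ + (2, 0)) = f GenG.y σ + f GenG.y (σ + (0, 1))

section Invariant

variable {f : GenG → St → ℤ}

lemma map_cnj {A B : Type*} [Group A] [Group B] (φ : A →* B) (a b : A) :
    φ (cnj a b) = cnj (φ a) (φ b) := by
  simp [cnj]

lemma genPerm_s (hf : Compatible f) : genPerm f GenG.s = baseShift (1, 0) := by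
  ext p <;> simp [genPerm, baseShift, mv, hf.s_zero]

lemma genPerm_t (hf : Compatible f) : genPerm f GenG.t = baseShift (0, 1) := by
  ext p <;> simp [genPerm, baseShift, mv, hf.t_zero]

lemma genPerm_x : genPerm f GenG.x = fibTrans (f GenG.x) := by
  ext p <;> simp [genPerm, fibTrans, mv]

lemma genPerm_y : genPerm f GenG.y = fibTrans (f GenG.y) := by
  ext p <;> simp [genPerm, fibTrans, mv]

lemma lift_conjsG (hf : Compatible f) {b : FG} (hb : b ∈ conjsG) :
    ∃ d, FreeGroup.lift (genPerm f) b = baseShift d := by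
  have hs : FreeGroup.lift (genPerm f) gs = baseShift (1, 0) := by
    simp [gs, genPerm_s hf]
  have ht : FreeGroup.lift (genPerm f) gt = baseShift (0, 1) := by
    simp [gt, genPerm_t hf]
  simp only [conjsG, List.mem_cons, List.not_mem_nil, or_false] at hb
  rcases hb with rfl | rfl | rfl | rfl | rfl | rfl | rfl | rfl <;>
    simp only [map_mul, map_pow, map_one, hs, ht, baseShift_pow, baseShift_mul,
      ← baseShift_zero] <;> exact ⟨_, rfl⟩

lemma lift_basisG (hf : Compatible f) {a : FG} (ha : a ∈ basisG) :
    ∃ h, FreeGroup.lift (genPerm f) a = fibTrans h := by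
  simp only [basisG, List.mem_append, List.mem_map] at ha
  rcases ha with ⟨b, hb, rfl⟩ | ⟨b, hb, rfl⟩ <;> obtain ⟨d, hd⟩ := lift_conjsG hf hb
  · refine ⟨fun σ => f GenG.x (σ + d), ?_⟩
    rw [map_cnj, hd, gx, FreeGroup.lift_apply_of, genPerm_x, cnj_fibTrans]
  · refine ⟨fun σ => f GenG.y (σ + d), ?_⟩
    rw [map_cnj, hd, gy, FreeGroup.lift_apply_of, genPerm_y, cnj_fibTrans]

lemma lift_relsG (hf : Compatible f) : ∀ r ∈ relsG, FreeGroup.lift (genPerm f) r = 1 := by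
  have hs : FreeGroup.lift (genPerm f) gs = baseShift (1, 0) := by
    simp [gs, genPerm_s hf]
  have ht : FreeGroup.lift (genPerm f) gt = baseShift (0, 1) := by
    simp [gt, genPerm_t hf]
  have hx : FreeGroup.lift (genPerm f) gx = fibTrans (f GenG.x) := by
    simp [gx, genPerm_x]
  have hy : FreeGroup.lift (genPerm f) gy = fibTrans (f GenG.y) := by
    simp [gy, genPerm_y]
  rintro r ((hr | ⟨a, ha, b, hb, rfl⟩) | rfl)
  · rcases hr with rfl | rfl | rfl
    · rw [map_pow, ht, baseShift_pow, ← baseShift_zero]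
      exact congrArg _ (by decide)
    · rw [map_pow, hs, baseShift_pow, ← baseShift_zero]
      exact congrArg _ (by decide)
    · simp only [map_mul, map_inv, hs, ht, baseShift_inv, baseShift_mul, ← baseShift_zero]
      exact congrArg _ (by decide)
  · obtain ⟨h, hh⟩ := lift_basisG hf ha
    obtain ⟨k, hk⟩ := lift_basisG hf hb
    rw [map_mul, map_mul, map_mul, map_inv, map_inv, hh, hk, fibTrans_commute h k]
    group
  · rw [map_mul, map_inv, mul_inv_eq_one, map_mul, map_mul, map_cnj, map_cnj, map_pow,
      hs, ht, hx, hy, baseShift_pow, cnj_fibTrans, cnj_fibTrans, fibTrans_mul, fibTrans_mul]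
    congr 1
    funext σ
    have h2 : (2 • (1, 0) : St) = (2, 0) := by decide
    rw [h2]
    exact hf.rel σ

/-- The action of `G` on `St × ℤ` determined by a compatible `f`. -/
def actG (hf : Compatible f) : G →* Equiv.Perm (St × ℤ) :=
  PresentedGroup.toGroup (lift_relsG hf)

lemma evalG_cons (a : GenG × Bool) (w : Word GenG) :
    evalG (a :: w) = (PresentedGroup.of a.1 : G) ^ sg a.2 * evalG w := by
  obtain ⟨g, b⟩ := a
  cases b <;> simp [evalG, evalWith, sg]

lemma actG_evalG (hf : Compatible f) (w : Word GenG) :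
    actG hf (evalG w) (0, 0) = (st w, tot (signed f) w) := by
  induction w with
  | nil => simp [evalG, evalWith, st, tot]
  | cons a w ih =>
    obtain ⟨g, b⟩ := a
    have hof : actG hf (PresentedGroup.of g) = genPerm f g := PresentedGroup.toGroup.of _
    rw [evalG_cons, map_mul, Equiv.Perm.mul_apply, ih, map_zpow, hof]
    cases b
    · have h : (genPerm f g ^ sg false) = (genPerm f g)⁻¹ := by simp [sg]
      have hstate : f g (st w - mv g) = f g (st w) := by
        cases g <;> simp [mv, hf.s_zero, hf.t_zero]
      rw [h]
      change (st w - mv g, tot (signed f) w - f g (st w - mv g)) = _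
      rw [hstate]
      simp [st, tot, sg, signed, sub_eq_add_neg, add_comm]
    · simp [genPerm, st, tot, sg, signed, add_comm]

lemma invariants_eq (hf : Compatible f) {w w' : Word GenG} (h : evalG w = evalG w') :
    st w = st w' ∧ tot (signed f) w = tot (signed f) w' := by
  have := (actG_evalG hf w).symm.trans ((by rw [h]) : _ = _) |>.trans (actG_evalG hf w')
  exact Prod.mk.inj this

end Invariant

/-! ### Calculus of totals -/

section Totals

variable {f g : GenG × Bool → St → ℤ}

lemma tot_congr {P : GenG × Bool → St → Prop} (h : ∀ a σ, P a σ → f a σ = g a σ)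
    {w : Word GenG} (hw : AllAt P w) : tot f w = tot g w := by
  induction w with
  | nil => rfl
  | cons a w ih => rw [tot, tot, h _ _ hw.1, ih hw.2]

lemma tot_add (w : Word GenG) : tot (fun a σ => f a σ + g a σ) w = tot f w + tot g w := by
  induction w with
  | nil => rfl
  | cons a w ih => simp only [tot, ih]; ring

lemma tot_mul (c : ℤ) (w : Word GenG) : tot (fun a σ => c * f a σ) w = c * tot f w := by
  induction w with
  | nil => simp [tot]
  | cons a w ih => simp only [tot, ih]; ring

lemma tot_le (h : ∀ a σ, f a σ ≤ g a σ) (w : Word GenG) : tot f w ≤ tot g w := by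
  induction w with
  | nil => rfl
  | cons a w ih => exact add_le_add (h _ _) ih

lemma vis_st (w : Word GenG) : vis (st w) w = true := by
  cases w <;> simp [vis, st]

lemma tot_le_of_not_vis {σ₀ : St} (h : ∀ a σ, σ ≠ σ₀ → f a σ ≤ g a σ) {w : Word GenG}
    (hw : vis σ₀ w = false) : tot f w ≤ tot g w := by
  induction w with
  | nil => rfl
  | cons a w ih =>
    rw [vis, Bool.or_eq_false_iff] at hw
    refine add_le_add (h _ _ ?_) (ih hw.1)
    rintro rfl
    simp [vis_st] at hw

lemma allAt_of_tot_eq (h : ∀ a σ, f a σ ≤ g a σ) {w : Word GenG} (hw : tot g w ≤ tot f w) :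
    AllAt (fun a σ => f a σ = g a σ) w := by
  induction w with
  | nil => trivial
  | cons a w ih =>
    simp only [tot] at hw
    have h1 := h a (st w)
    have h2 := tot_le h w
    exact ⟨by linarith, ih (by linarith)⟩

lemma AllAt.mono {P Q : GenG × Bool → St → Prop} (h : ∀ a σ, P a σ → Q a σ) {w : Word GenG}
    (hw : AllAt P w) : AllAt Q w := by
  induction w with
  | nil => trivial
  | cons a w ih => exact ⟨h _ _ hw.1, ih hw.2⟩

lemma AllAt.right {P : GenG × Bool → St → Prop} {u v : Word GenG} (h : AllAt P (u ++ v)) :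
    AllAt P v := by
  induction u with
  | nil => exact h
  | cons a u ih => exact ih h.2

lemma st_append (u v : Word GenG) : st (u ++ v) = st u + st v := by
  induction u with
  | nil => simp [st]
  | cons a u ih => simp only [List.cons_append, st, ih]; abel

lemma AllAt.replace {P : GenG × Bool → St → Prop} {u v v' : Word GenG} (h : AllAt P (u ++ v))
    (h' : AllAt P v') (hst : st v = st v') : AllAt P (u ++ v') := by
  induction u with
  | nil => exact h'
  | cons a u ih =>
    have h1 : P a (st (u ++ v)) := h.1
    rw [st_append, hst, ← st_append] at h1
    exact ⟨h1, ih h.2⟩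

lemma tot_replace {v v' : Word GenG} (u : Word GenG) (hst : st v = st v') :
    tot f (u ++ v') - tot f v' = tot f (u ++ v) - tot f v := by
  induction u with
  | nil => simp
  | cons a u ih =>
    simp only [List.cons_append, tot, st_append, hst]
    linarith

lemma st_append_of_not_move {l : Word GenG} (hl : ∀ a ∈ l, isMove a.1 = false)
    (v : Word GenG) : st (l ++ v) = st v := by
  induction l with
  | nil => rfl
  | cons a l ih =>
    have ha := hl a (by simp)
    have h0 : mv a.1 = 0 := by
      obtain ⟨g, b⟩ := a
      cases g <;> simp_all [isMove, mv]
    rw [List.cons_append, st, ih fun b hb => hl b (by simp [hb]), h0, smul_zero, add_zero]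

lemma st_replicate_append {g : GenG} {b : Bool} (ha : isMove g = false) (n : ℕ)
    (v : Word GenG) : st (List.replicate n (g, b) ++ v) = st v :=
  st_append_of_not_move (fun b hb => by rw [List.eq_of_mem_replicate hb, ha]) v

lemma tot_replicate_append {g : GenG} {b : Bool} (ha : isMove g = false) (n : ℕ)
    (v : Word GenG) :
    tot f (List.replicate n (g, b) ++ v) = n * f (g, b) (st v) + tot f v := by
  induction n with
  | zero => simp
  | succ n ih =>
    rw [List.replicate_succ, List.cons_append, tot, st_replicate_append ha, ih]
    push_cast
    ring

lemma tot_one (w : Word GenG) : tot (fun _ _ => 1) w = w.length := by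
  induction w with
  | nil => rfl
  | cons a w ih => simp only [tot, ih, List.length_cons]; push_cast; ring

/-- Iterating a loop `l` in front of `v`. -/
def pump (l v : Word GenG) : ℕ → Word GenG
  | 0 => v
  | k + 1 => l ++ pump l v k

lemma st_pump {l v : Word GenG} (h : st (l ++ v) = st v) (k : ℕ) : st (pump l v k) = st v := by
  induction k with
  | zero => rfl
  | succ k ih => rw [pump, st_append, ih, ← st_append, h]

lemma tot_pump {l v : Word GenG} (h : st (l ++ v) = st v) (k : ℕ) :
    tot f (pump l v k) = tot f v + k * (tot f (l ++ v) - tot f v) := by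
  induction k with
  | zero => simp [pump]
  | succ k ih =>
    have := tot_replace (f := f) l (st_pump h k).symm
    rw [pump]
    push_cast
    linarith

lemma AllAt.pump {P : GenG × Bool → St → Prop} {l v : Word GenG} (h : st (l ++ v) = st v)
    (hP : AllAt P (l ++ v)) (k : ℕ) : AllAt P (pump l v k) := by
  induction k with
  | zero => exact hP.right
  | succ k ih => exact hP.replace ih (st_pump h k).symm

lemma evalFrom_pump {σ : Type*} (M : DFA (GenG × Bool) σ) {q : σ} {l v : Word GenG}
    (h : M.evalFrom q l = q) (k : ℕ) : M.evalFrom q (NS.pump l v k) = M.evalFrom q v := by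
  induction k with
  | zero => rfl
  | succ k ih => rw [NS.pump, DFA.evalFrom_of_append, h, ih]

end Totals

/-! ### Contributions of letters -/

/-- Difference of the exponents of `x` and `x^{s²}`. -/
def diffX : GenG → St → ℤ
  | GenG.x, σ => if σ = 0 then 1 else if σ = (2, 0) then -1 else 0
  | _, _ => 0

/-- Difference of the exponents of `y` and `y^t`. -/
def diffY : GenG → St → ℤ
  | GenG.y, σ => if σ = 0 then 1 else if σ = (0, 1) then -1 else 0
  | _, _ => 0

/-- Total exponent in the states `1, s², t, ts²`. -/
def height : GenG → St → ℤ
  | GenG.x, σ => if σ.1 = 0 ∨ σ.1 = 2 then 1 else 0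
  | GenG.y, σ => if σ.1 = 0 ∨ σ.1 = 2 then 1 else 0
  | _, _ => 0

lemma compatible_diffX : Compatible diffX :=
  ⟨fun _ => rfl, fun _ => rfl, by decide⟩

lemma compatible_diffY : Compatible diffY :=
  ⟨fun _ => rfl, fun _ => rfl, by decide⟩

lemma compatible_height : Compatible height :=
  ⟨fun _ => rfl, fun _ => rfl, by decide⟩

/-- Indicator of the letters `s^{±1}, t^{±1}`. -/
def moveInd (a : GenG × Bool) (_ : St) : ℤ := if isMove a.1 then 1 else 0

/-- Indicator of the letters `x^{±1}, y^{±1}`. -/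
def outInd (a : GenG × Bool) (_ : St) : ℤ := if isMove a.1 then 0 else 1

/-- Indicator of a given letter in a given state. -/
def ind (a₀ : GenG × Bool) (σ₀ : St) (a : GenG × Bool) (σ : St) : ℤ :=
  if a = a₀ ∧ σ = σ₀ then 1 else 0

/-- The letters `s^{±1}, t^{±1}` in any state, `x, y` in state `1`, `x⁻¹` in state `s²` and `y⁻¹`
in state `t`. -/
def Nice (a : GenG × Bool) (σ : St) : Prop :=
  isMove a.1 = true ∨ (a = (GenG.x, true) ∧ σ = 0) ∨ (a = (GenG.y, true) ∧ σ = 0) ∨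
    (a = (GenG.x, false) ∧ σ = (2, 0)) ∨ (a = (GenG.y, false) ∧ σ = (0, 1))

/-- Number of letters `x` in state `1`. -/
abbrev cX (w : Word GenG) : ℤ := tot (ind (GenG.x, true) 0) w
/-- Number of letters `y` in state `1`. -/
abbrev cY (w : Word GenG) : ℤ := tot (ind (GenG.y, true) 0) w
/-- Number of letters `x⁻¹` in state `s²`. -/
abbrev cX' (w : Word GenG) : ℤ := tot (ind (GenG.x, false) (2, 0)) w
/-- Number of letters `y⁻¹` in state `t`. -/
abbrev cY' (w : Word GenG) : ℤ := tot (ind (GenG.y, false) (0, 1)) w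

lemma length_eq (w : Word GenG) : (w.length : ℤ) = tot outInd w + tot moveInd w := by
  rw [← tot_one, ← tot_add]
  congr 1
  funext a σ
  obtain ⟨g, b⟩ := a
  cases g <;> rfl

lemma nice_of_diff_eq (a : GenG × Bool) (σ : St)
    (h : signed diffX a σ + signed diffY a σ = outInd a σ) : Nice a σ := by
  obtain ⟨g, b⟩ := a
  revert σ
  unfold Nice
  cases g <;> cases b <;> decide

lemma diff_le_outInd (a : GenG × Bool) (σ : St) :
    signed diffX a σ + signed diffY a σ ≤ outInd a σ := by
  obtain ⟨g, b⟩ := a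
  revert σ
  cases g <;> cases b <;> decide

lemma diffX_height_le (a : GenG × Bool) (σ : St) (h : σ ≠ (2, 0)) :
    2 * signed diffX a σ + -1 * signed height a σ ≤ outInd a σ := by
  obtain ⟨g, b⟩ := a
  revert σ
  cases g <;> cases b <;> decide

lemma diffY_height_le (a : GenG × Bool) (σ : St) (h : σ ≠ (0, 1)) :
    2 * signed diffY a σ + -1 * signed height a σ ≤ outInd a σ := by
  obtain ⟨g, b⟩ := a
  revert σ
  cases g <;> cases b <;> decide

lemma nice_diffX {w : Word GenG} (hw : AllAt Nice w) : tot (signed diffX) w = cX w + cX' w := by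
  rw [← tot_add]
  refine tot_congr (fun a σ h => ?_) hw
  obtain ⟨g, b⟩ := a
  revert σ
  unfold Nice
  cases g <;> cases b <;> decide

lemma nice_diffY {w : Word GenG} (hw : AllAt Nice w) : tot (signed diffY) w = cY w + cY' w := by
  rw [← tot_add]
  refine tot_congr (fun a σ h => ?_) hw
  obtain ⟨g, b⟩ := a
  revert σ
  unfold Nice
  cases g <;> cases b <;> decide

lemma nice_height {w : Word GenG} (hw : AllAt Nice w) :
    tot (signed height) w = (cX w + cY w) + -1 * (cX' w + cY' w) := by
  rw [← tot_add, ← tot_add, ← tot_mul, ← tot_add]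
  refine tot_congr (fun a σ h => ?_) hw
  obtain ⟨g, b⟩ := a
  revert σ
  unfold Nice
  cases g <;> cases b <;> decide

lemma nice_outInd {w : Word GenG} (hw : AllAt Nice w) :
    tot outInd w = (cX w + cY w) + (cX' w + cY' w) := by
  rw [← tot_add, ← tot_add, ← tot_add]
  refine tot_congr (fun a σ h => ?_) hw
  obtain ⟨g, b⟩ := a
  revert σ
  unfold Nice
  cases g <;> cases b <;> decide

/-! ### The cost of visiting states -/

/-- Word length in the state group. -/
def dist0 (σ : St) : ℕ := (if σ.1 = 0 then 0 else if σ.1 = 2 then 2 else 1) + σ.2.val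

/-- Lower bound for the number of moves needed to end in `σ`, having visited `t` if `b` and `s²`
if `c`. -/
def moveBound (σ : St) (b c : Bool) : ℕ :=
  match b, c with
  | false, false => dist0 σ
  | true, false => 1 + dist0 (σ - (0, 1))
  | false, true => 2 + dist0 (σ - (2, 0))
  | true, true => min (4 + dist0 (σ - (2, 0))) (5 + dist0 (σ - (0, 1)))

lemma moveBound_step (a : GenG × Bool) (σ : St) (b c : Bool) (ha : isMove a.1 = true) :
    moveBound (σ + sg a.2 • mv a.1) (b || decide (σ + sg a.2 • mv a.1 = (0, 1)))
      (c || decide (σ + sg a.2 • mv a.1 = (2, 0))) ≤ moveBound σ b c + 1 := by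
  obtain ⟨g, e⟩ := a
  revert σ b c
  cases g <;> cases e <;> first | (cases ha; done) | decide

lemma moveBound_le (w : Word GenG) :
    (moveBound (st w) (vis (0, 1) w) (vis (2, 0) w) : ℤ) ≤ tot moveInd w := by
  induction w with
  | nil => decide
  | cons a w ih =>
    rcases ha : isMove a.1 with _ | _
    · have hst : st (a :: w) = st w :=
        st_append_of_not_move (l := [a]) (by simpa using ha) w
      have hv (σ : St) : vis σ (a :: w) = vis σ w := by
        rw [vis, hst]
        by_cases h : st w = σ
        · subst h; simp [vis_st]
        · simp [h]
      rw [hv, hv, hst, tot]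
      simpa [moveInd, ha] using ih
    · have := moveBound_step a (st w) (vis (0, 1) w) (vis (2, 0) w) ha
      have h1 : tot moveInd (a :: w) = 1 + tot moveInd w := by simp [tot, moveInd, ha]
      change ((moveBound (st w + sg a.2 • mv a.1)
        (vis (0, 1) w || decide (st w + sg a.2 • mv a.1 = (0, 1)))
        (vis (2, 0) w || decide (st w + sg a.2 • mv a.1 = (2, 0))) : ℕ) : ℤ) ≤ _
      omega

/-! ### Normal forms in `G` -/

/-- The element `x^{s²}`. -/
def Gx' : G := cnj Gx (Gs ^ 2)
/-- The element `y^t`. -/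
def Gy' : G := cnj Gy Gt

/-- Quotient map from the free group on the generators to `G`. -/
abbrev quotG : FG →* G := PresentedGroup.mk relsG

lemma rel_one {r : FG} (h : r ∈ relsG) : quotG r = 1 := PresentedGroup.one_of_mem h

lemma Gt_sq : Gt ^ 2 = 1 := by
  have := rel_one (r := gt ^ 2) (by simp [relsG])
  rwa [map_pow] at this

lemma Gs_pow_four : Gs ^ 4 = 1 := by
  have := rel_one (r := gs ^ 4) (by simp [relsG])
  rwa [map_pow] at this

lemma Gs_Gt_commute : Commute Gs Gt := by
  have := rel_one (r := gs⁻¹ * gt⁻¹ * gs * gt) (by simp [relsG])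
  simp only [map_mul, map_inv] at this
  have h : (Gt * Gs)⁻¹ * (Gs * Gt) = 1 := by
    rw [mul_inv_rev, ← mul_assoc]
    exact this
  exact (inv_mul_eq_one.mp h).symm

lemma Gx_mul_Gx' : Gx * Gx' = Gy * Gy' := by
  have := rel_one (r := gx * cnj gx (gs ^ 2) * (gy * cnj gy gt)⁻¹) (by simp [relsG])
  rwa [map_mul, map_inv, mul_inv_eq_one, map_mul, map_mul, map_cnj, map_cnj, map_pow] at this

lemma commute_of_mem_basisG {a b : FG} (ha : a ∈ basisG) (hb : b ∈ basisG) :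
    Commute (quotG a) (quotG b) := by
  have := rel_one (r := a * b * a⁻¹ * b⁻¹) (Or.inl (Or.inr ⟨a, ha, b, hb, rfl⟩))
  rwa [map_mul, map_mul, map_mul, map_inv, map_inv, mul_inv_eq_one, mul_inv_eq_iff_eq_mul] at this

lemma mem_basisG :
    gx ∈ basisG ∧ gy ∈ basisG ∧ cnj gx (gs ^ 2) ∈ basisG ∧ cnj gy gt ∈ basisG := by
  refine ⟨?_, ?_, ?_, ?_⟩ <;> simp [basisG, conjsG, cnj]

lemma quotG_basis : quotG gx = Gx ∧ quotG gy = Gy ∧ quotG (cnj gx (gs ^ 2)) = Gx' ∧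
    quotG (cnj gy gt) = Gy' := by
  refine ⟨rfl, rfl, ?_, ?_⟩
  · rw [map_cnj, map_pow]; rfl
  · rw [map_cnj]; rfl

lemma commute_Gx_Gy : Commute Gx Gy :=
  commute_of_mem_basisG mem_basisG.1 mem_basisG.2.1

lemma commute_Gx_Gx' : Commute Gx Gx' := by
  have := commute_of_mem_basisG mem_basisG.1 mem_basisG.2.2.1
  rwa [quotG_basis.1, quotG_basis.2.2.1] at this

lemma commute_Gx_Gy' : Commute Gx Gy' := by
  have := commute_of_mem_basisG mem_basisG.1 mem_basisG.2.2.2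
  rwa [quotG_basis.1, quotG_basis.2.2.2] at this

lemma commute_Gy_Gx' : Commute Gy Gx' := by
  have := commute_of_mem_basisG mem_basisG.2.1 mem_basisG.2.2.1
  rwa [quotG_basis.2.1, quotG_basis.2.2.1] at this

lemma commute_Gy_Gy' : Commute Gy Gy' := by
  have := commute_of_mem_basisG mem_basisG.2.1 mem_basisG.2.2.2
  rwa [quotG_basis.2.1, quotG_basis.2.2.2] at this

lemma commute_Gx'_Gy' : Commute Gx' Gy' := by
  have := commute_of_mem_basisG mem_basisG.2.2.1 mem_basisG.2.2.2
  rwa [quotG_basis.2.2.1, quotG_basis.2.2.2] at this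

/-- The element `x^a y^b (x^{s²})^{-c} (y^t)^{-d}`. -/
def nf (a b c d : ℤ) : G := Gx ^ a * Gy ^ b * Gx' ^ (-c) * Gy' ^ (-d)

lemma Gx_mul_nf (a b c d : ℤ) : Gx * nf a b c d = nf (a + 1) b c d := by
  simp only [nf, ← mul_assoc]
  rw [add_comm, zpow_add, zpow_one]

lemma Gy_mul_nf (a b c d : ℤ) : Gy * nf a b c d = nf a (b + 1) c d := by
  simp only [nf, ← mul_assoc]
  rw [(commute_Gx_Gy.symm.zpow_right a).eq, add_comm, zpow_add, zpow_one]
  simp only [mul_assoc]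

lemma Gx'_inv_mul_nf (a b c d : ℤ) : Gx'⁻¹ * nf a b c d = nf a b (c + 1) d := by
  have h : Commute Gx'⁻¹ (Gx ^ a * Gy ^ b) :=
    ((commute_Gx_Gx'.symm.zpow_right a).mul_right (commute_Gy_Gx'.symm.zpow_right b)).inv_left
  simp only [nf, ← mul_assoc]
  rw [mul_assoc Gx'⁻¹, h.eq, mul_assoc (Gx ^ a * Gy ^ b), neg_add_rev, zpow_add, zpow_neg_one]

lemma Gy'_inv_mul_nf (a b c d : ℤ) : Gy'⁻¹ * nf a b c d = nf a b c (d + 1) := by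
  have h : Commute Gy'⁻¹ (Gx ^ a * Gy ^ b * Gx' ^ (-c)) :=
    (((commute_Gx_Gy'.symm.zpow_right a).mul_right
      (commute_Gy_Gy'.symm.zpow_right b)).mul_right
      (commute_Gx'_Gy'.symm.zpow_right (-c))).inv_left
  rw [nf, nf, ← mul_assoc, h.eq, mul_assoc, neg_add_rev, zpow_add, zpow_neg_one]

lemma nf_shift (k a b c d : ℤ) : nf a b c d = nf (a - k) (b + k) (c + k) (d - k) := by
  have h1 : Gx ^ (-k) * Gx' ^ (-k) = Gy ^ (-k) * Gy' ^ (-k) := by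
    rw [← commute_Gx_Gx'.mul_zpow, ← commute_Gy_Gy'.mul_zpow, Gx_mul_Gx']
  have e1 : nf (a - k) (b + k) (c + k) (d - k) =
      Gx ^ a * (Gy ^ k * Gy ^ b) * (Gx ^ (-k) * Gx' ^ (-k)) * Gx' ^ (-c) *
        (Gy' ^ k * Gy' ^ (-d)) := by
    have c1 : Commute (Gx ^ (-k)) (Gy ^ k * Gy ^ b) :=
      (((commute_Gx_Gy.zpow_left _).zpow_right _).mul_right
        ((commute_Gx_Gy.zpow_left _).zpow_right _))
    rw [nf, show a - k = a + -k by ring, show b + k = k + b by ring,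
      show -(c + k) = -k + -c by ring, show -(d - k) = k + -d by ring,
      zpow_add, zpow_add, zpow_add, zpow_add, mul_assoc (Gx ^ a) (Gx ^ (-k)), c1.eq]
    simp only [mul_assoc]
  have c2 : Commute (Gy' ^ (-k)) (Gx' ^ (-c)) :=
    (commute_Gx'_Gy'.symm.zpow_left _).zpow_right _
  have c3 : Commute (Gy ^ b) (Gy ^ (-k)) := Commute.zpow_zpow_self _ _ _
  have e2 : Gx ^ a * (Gy ^ k * Gy ^ b) * (Gy ^ (-k) * Gy' ^ (-k)) * Gx' ^ (-c) *
      (Gy' ^ k * Gy' ^ (-d)) = Gx ^ a * (Gy ^ k * (Gy ^ b * Gy ^ (-k))) *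
        (Gy' ^ (-k) * Gx' ^ (-c)) * Gy' ^ k * Gy' ^ (-d) := by
    simp only [mul_assoc]
  rw [e1, h1, e2, c2.eq, c3.eq, nf]
  simp [mul_assoc]

/-- The lift of a state to `G`. -/
def stG (σ : St) : G := Gs ^ σ.1.val * Gt ^ σ.2.val

lemma Gs_mul_stG (σ : St) : Gs * stG σ = stG (σ + (1, 0)) := by
  obtain ⟨i, j⟩ := σ
  have h : Gs * Gs ^ i.val = Gs ^ (i + 1).val := by
    rw [← pow_succ']
    fin_cases i
    · rfl
    · rfl
    · rfl
    · exact Gs_pow_four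
  simp only [stG, Prod.mk_add_mk, add_zero]
  rw [← mul_assoc, h]

lemma Gt_mul_stG (σ : St) : Gt * stG σ = stG (σ + (0, 1)) := by
  obtain ⟨i, j⟩ := σ
  have h : Gt * Gt ^ j.val = Gt ^ (j + 1).val := by
    rw [← pow_succ']
    fin_cases j
    · rfl
    · exact Gt_sq
  simp only [stG, Prod.mk_add_mk, add_zero]
  rw [← mul_assoc, (Gs_Gt_commute.symm.pow_right _).eq, mul_assoc, h]

lemma move_mul_stG {g : GenG} (hg : isMove g = true) (σ : St) (b : Bool) :
    (PresentedGroup.of g : G) ^ sg b * stG σ = stG (σ + sg b • mv g) := by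
  have key (σ : St) : (PresentedGroup.of g : G) * stG σ = stG (σ + mv g) := by
    cases g
    · cases hg
    · cases hg
    · exact Gs_mul_stG σ
    · exact Gt_mul_stG σ
  cases b
  · simp only [sg, Bool.false_eq_true, if_false, zpow_neg_one, neg_smul, one_smul]
    rw [inv_mul_eq_iff_eq_mul, key]
    simp
  · simpa [sg] using key σ

lemma evalG_of_nice {w : Word GenG} (hw : AllAt Nice w) :
    evalG w = stG (st w) * nf (cX w) (cY w) (cX' w) (cY' w) := by
  have hst0 : stG 0 = 1 := by simp [stG]
  have hst2 : stG (2, 0) = Gs ^ 2 := by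
    change Gs ^ 2 * Gt ^ 0 = _
    simp
  have hst1 : stG (0, 1) = Gt := by
    change Gs ^ 0 * Gt ^ 1 = _
    simp
  induction w with
  | nil => simp [evalG, evalWith, st, tot, stG, nf]
  | cons a w ih =>
    rw [evalG_cons, ih hw.2]
    rcases hw.1 with h | ⟨rfl, h⟩ | ⟨rfl, h⟩ | ⟨rfl, h⟩ | ⟨rfl, h⟩
    · rw [← mul_assoc, move_mul_stG h]
      have hz {g : GenG} (b : Bool) (σ₀ : St) (h₀ : isMove g = false) :
          tot (ind (g, b) σ₀) (a :: w) = tot (ind (g, b) σ₀) w := by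
        rw [tot, ind, if_neg, zero_add]
        rintro ⟨rfl, -⟩
        simp [h] at h₀
      have hx : isMove GenG.x = false := rfl
      have hy : isMove GenG.y = false := rfl
      rw [cX, cY, cX', cY', ← hz _ _ hx, ← hz _ _ hy, ← hz _ _ hx, ← hz _ _ hy]
      rfl
    · have : Gx * nf (cX w) (cY w) (cX' w) (cY' w) = nf (cX w + 1) (cY w) (cX' w) (cY' w) :=
        Gx_mul_nf ..
      simp [cX, cY, cX', cY', tot, st, mv, ind, h, hst0, sg, add_comm] at this ⊢
      exact this
    · have : Gy * nf (cX w) (cY w) (cX' w) (cY' w) = nf (cX w) (cY w + 1) (cX' w) (cY' w) :=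
        Gy_mul_nf ..
      simp [cX, cY, cX', cY', tot, st, mv, ind, h, hst0, sg, add_comm] at this ⊢
      exact this
    · have h1 := Gx'_inv_mul_nf (cX w) (cY w) (cX' w) (cY' w)
      have h2 : Gx⁻¹ * Gs ^ 2 = Gs ^ 2 * Gx'⁻¹ := by simp only [Gx', cnj]; group
      have : Gx⁻¹ * (Gs ^ 2 * nf (cX w) (cY w) (cX' w) (cY' w)) =
          Gs ^ 2 * nf (cX w) (cY w) (cX' w + 1) (cY' w) := by
        rw [← mul_assoc, h2, mul_assoc, h1]
      simp [cX, cY, cX', cY', tot, st, mv, ind, h, hst2, sg, add_comm] at this ⊢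
      exact this
    · have h1 := Gy'_inv_mul_nf (cX w) (cY w) (cX' w) (cY' w)
      have h2 : Gy⁻¹ * Gt = Gt * Gy'⁻¹ := by simp only [Gy', cnj]; group
      have : Gy⁻¹ * (Gt * nf (cX w) (cY w) (cX' w) (cY' w)) =
          Gt * nf (cX w) (cY w) (cX' w) (cY' w + 1) := by
        rw [← mul_assoc, h2, mul_assoc, h1]
      simp [cX, cY, cX', cY', tot, st, mv, ind, h, hst1, sg, add_comm] at this ⊢
      exact this

lemma AllAt.replicate_append {P : GenG × Bool → St → Prop} {g : GenG} {b : Bool} (n : ℕ)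
    {v : Word GenG} (ha : isMove g = false) (hP : P (g, b) (st v)) (hv : AllAt P v) :
    AllAt P (List.replicate n (g, b) ++ v) := by
  induction n with
  | zero => exact hv
  | succ n ih =>
    rw [← st_replicate_append (b := b) ha n v] at hP
    exact ⟨hP, ih⟩

/-! ### Explicit words -/

/-- A word without letters in state `t`. -/
def wordViaSS (p q r : ℕ) : Word GenG :=
  (GenG.t, true) :: (List.replicate r (GenG.x, false) ++ (GenG.s, true) :: (GenG.s, true) ::
    (List.replicate p (GenG.x, true) ++ (List.replicate q (GenG.y, true) ++ [])))

/-- A word without letters in state `s²`. -/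
def wordViaT (p q r : ℕ) : Word GenG :=
  (GenG.s, true) :: (GenG.s, true) :: (List.replicate r (GenG.y, false) ++ (GenG.t, true) ::
    (List.replicate p (GenG.x, true) ++ (List.replicate q (GenG.y, true) ++ [])))

/-- Words whose states `t` and `s²` both carry letters. -/
def wordTarget (n : ℕ) : Word GenG :=
  (GenG.t, true) :: (List.replicate n (GenG.x, false) ++ (GenG.s, true) :: (GenG.s, true) ::
    (GenG.t, true) :: (List.replicate (2 * n) (GenG.y, false) ++ (GenG.t, true) ::
      (List.replicate n (GenG.x, true) ++ [])))

lemma length_wordViaSS (p q r : ℕ) : (wordViaSS p q r).length = p + q + r + 3 := by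
  simp [wordViaSS]; omega

lemma length_wordViaT (p q r : ℕ) : (wordViaT p q r).length = p + q + r + 3 := by
  simp [wordViaT]; omega

lemma length_wordTarget (n : ℕ) : (wordTarget n).length = 4 * n + 5 := by
  simp [wordTarget]; omega

lemma st_wordTarget (n : ℕ) : st (wordTarget n) = (2, 1) := by
  simp only [wordTarget, st, st_replicate_append (show isMove GenG.x = false from rfl),
    st_replicate_append (show isMove GenG.y = false from rfl)]
  decide

lemma allAt_wordViaSS (p q r : ℕ) : AllAt Nice (wordViaSS p q r) := by
  refine ⟨Or.inl rfl, AllAt.replicate_append r rfl ?_ ⟨Or.inl rfl, Or.inl rfl,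
    AllAt.replicate_append p rfl ?_ (AllAt.replicate_append q rfl ?_ trivial)⟩⟩
  all_goals
    simp only [st, st_replicate_append (show isMove GenG.x = false from rfl),
      st_replicate_append (show isMove GenG.y = false from rfl)]
    unfold Nice
    decide

lemma allAt_wordViaT (p q r : ℕ) : AllAt Nice (wordViaT p q r) := by
  refine ⟨Or.inl rfl, Or.inl rfl, AllAt.replicate_append r rfl ?_ ⟨Or.inl rfl,
    AllAt.replicate_append p rfl ?_ (AllAt.replicate_append q rfl ?_ trivial)⟩⟩
  all_goals
    simp only [st, st_replicate_append (show isMove GenG.x = false from rfl),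
      st_replicate_append (show isMove GenG.y = false from rfl)]
    unfold Nice
    decide

lemma allAt_wordTarget (n : ℕ) : AllAt Nice (wordTarget n) := by
  refine ⟨Or.inl rfl, AllAt.replicate_append n rfl ?_ ⟨Or.inl rfl, Or.inl rfl, Or.inl rfl,
    AllAt.replicate_append (2 * n) rfl ?_ ⟨Or.inl rfl,
      AllAt.replicate_append n rfl ?_ trivial⟩⟩⟩
  all_goals
    simp only [st, st_replicate_append (show isMove GenG.x = false from rfl),
      st_replicate_append (show isMove GenG.y = false from rfl)]
    unfold Nice
    decide

lemma count_wordTarget (n : ℕ) : cX (wordTarget n) = n ∧ cY (wordTarget n) = 0 ∧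
    cX' (wordTarget n) = n ∧ cY' (wordTarget n) = 2 * n := by
  refine ⟨?_, ?_, ?_, ?_⟩
  all_goals
    simp only [wordTarget, cX, cY, cX', cY', tot, st,
    tot_replicate_append (show isMove GenG.x = false from rfl),
    tot_replicate_append (show isMove GenG.y = false from rfl),
    st_replicate_append (show isMove GenG.x = false from rfl),
    st_replicate_append (show isMove GenG.y = false from rfl)]
    simp [ind, mv, sg, one_add_one_eq_two, show (2 : ZMod 2) = 0 from rfl]

lemma evalG_wordViaSS (p q r : ℕ) : evalG (wordViaSS p q r) = stG (2, 1) * nf p q r 0 := by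
  rw [evalG_of_nice (allAt_wordViaSS p q r)]
  have h : cX (wordViaSS p q r) = p ∧ cY (wordViaSS p q r) = q ∧ cX' (wordViaSS p q r) = r ∧
      cY' (wordViaSS p q r) = 0 := by
    refine ⟨?_, ?_, ?_, ?_⟩
    all_goals
      simp only [wordViaSS, cX, cY, cX', cY', tot, st,
      tot_replicate_append (show isMove GenG.x = false from rfl),
      tot_replicate_append (show isMove GenG.y = false from rfl),
      st_replicate_append (show isMove GenG.x = false from rfl),
      st_replicate_append (show isMove GenG.y = false from rfl)]
      simp [ind, mv, sg, one_add_one_eq_two]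
  have hst : st (wordViaSS p q r) = (2, 1) := by
    simp only [wordViaSS, st, st_replicate_append (show isMove GenG.x = false from rfl),
      st_replicate_append (show isMove GenG.y = false from rfl)]
    decide
  rw [h.1, h.2.1, h.2.2.1, h.2.2.2, hst]

lemma evalG_wordViaT (p q r : ℕ) : evalG (wordViaT p q r) = stG (2, 1) * nf p q 0 r := by
  rw [evalG_of_nice (allAt_wordViaT p q r)]
  have h : cX (wordViaT p q r) = p ∧ cY (wordViaT p q r) = q ∧ cX' (wordViaT p q r) = 0 ∧
      cY' (wordViaT p q r) = r := by
    refine ⟨?_, ?_, ?_, ?_⟩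
    all_goals
      simp only [wordViaT, cX, cY, cX', cY', tot, st,
      tot_replicate_append (show isMove GenG.x = false from rfl),
      tot_replicate_append (show isMove GenG.y = false from rfl),
      st_replicate_append (show isMove GenG.x = false from rfl),
      st_replicate_append (show isMove GenG.y = false from rfl)]
      simp [ind, mv, sg]
  have hst : st (wordViaT p q r) = (2, 1) := by
    simp only [wordViaT, st, st_replicate_append (show isMove GenG.x = false from rfl),
      st_replicate_append (show isMove GenG.y = false from rfl)]
    decide
  rw [h.1, h.2.1, h.2.2.1, h.2.2.2, hst]

/-! ### Geodesics -/

lemma IsGeodesicG.length_le {w w' : Word GenG} (h : IsGeodesicG w) (e : evalG w' = evalG w) :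
    w.length ≤ w'.length := by
  rw [h]
  exact Nat.sInf_le ⟨w', e, rfl⟩

/-- A word which is no longer than `wordTarget n` and has the same value uses the same letters. -/
lemma shape_of_short {n : ℕ} (hn : 3 ≤ n) {w : Word GenG} (he : evalG w = evalG (wordTarget n))
    (hlen : w.length ≤ 4 * n + 5) :
    AllAt Nice w ∧ st w = (2, 1) ∧ tot moveInd w = 5 ∧ cX w + cX' w = 2 * n ∧
      cY w + cY' w = 2 * n ∧ cX w + cY w = n := by
  obtain ⟨hst, hX⟩ := invariants_eq compatible_diffX he
  have hY := (invariants_eq compatible_diffY he).2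
  have hH := (invariants_eq compatible_height he).2
  obtain ⟨c1, c2, c3, c4⟩ := count_wordTarget n
  have hT := allAt_wordTarget n
  rw [st_wordTarget] at hst
  rw [nice_diffX hT, c1, c3] at hX
  rw [nice_diffY hT, c2, c4] at hY
  rw [nice_height hT, c1, c2, c3, c4] at hH
  have hl := length_eq w
  have hout : 4 * (n : ℤ) ≤ tot outInd w := by
    have := tot_le diff_le_outInd w
    rw [tot_add] at this
    linarith
  have hmove : 5 ≤ tot moveInd w := by
    have hb := moveBound_le w
    rw [hst] at hb
    rcases h1 : vis (2, 0) w with _ | _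
    · have := tot_le_of_not_vis diffX_height_le h1
      rw [tot_add, tot_mul, tot_mul] at this
      omega
    rcases h2 : vis (0, 1) w with _ | _
    · have := tot_le_of_not_vis diffY_height_le h2
      rw [tot_add, tot_mul, tot_mul] at this
      omega
    · rw [h1, h2] at hb
      exact hb
  have hnice : AllAt Nice w := by
    refine (allAt_of_tot_eq diff_le_outInd ?_).mono nice_of_diff_eq
    rw [tot_add]
    omega
  rw [nice_diffX hnice] at hX
  rw [nice_diffY hnice] at hY
  rw [nice_height hnice] at hH
  refine ⟨hnice, hst, ?_, ?_, ?_, ?_⟩ <;> omega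

/-- Indicator of the letters `x^{±1}, y^{±1}` read in state `1`. -/
def zeroInd (a : GenG × Bool) (σ : St) : ℤ := if isMove a.1 = false ∧ σ = 0 then 1 else 0

lemma nice_zeroInd {w : Word GenG} (hw : AllAt Nice w) : tot zeroInd w = cX w + cY w := by
  rw [← tot_add]
  refine tot_congr (fun a σ h => ?_) hw
  obtain ⟨g, b⟩ := a
  revert σ
  unfold Nice
  cases g <;> cases b <;> decide

/-- A word with many letters read in state `1` but few moves has a long block of letters read
in state `1` without moves. -/
lemma exists_block (K : ℕ) (w : Word GenG) (h : K * tot moveInd w + K < tot zeroInd w) :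
    ∃ u l v, w = u ++ (l ++ v) ∧ K ≤ l.length ∧ (∀ a ∈ l, isMove a.1 = false) ∧ st v = 0 := by
  suffices H : (∃ u l v, w = u ++ (l ++ v) ∧ K ≤ l.length ∧ (∀ a ∈ l, isMove a.1 = false) ∧
      st v = 0) ∨ ∃ l v, w = l ++ v ∧ l.length ≤ K ∧ (∀ a ∈ l, isMove a.1 = false) ∧
      (l = [] ∨ st v = 0) ∧ tot zeroInd w ≤ K * tot moveInd w + l.length by
    rcases H with H | ⟨l, v, -, hl, -, -, hz⟩
    · exact H
    · omega
  clear h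
  induction w with
  | nil => exact Or.inr ⟨[], [], by simp [tot]⟩
  | cons a w ih =>
    rcases ih with ⟨u, l, v, rfl, h⟩ | ⟨l, v, rfl, hlK, hl, hv, hz⟩
    · exact Or.inl ⟨a :: u, l, v, rfl, h⟩
    rcases ha : isMove a.1 with _ | _
    · have hst := st_append_of_not_move hl v
      by_cases h0 : st v = 0
      · by_cases hlt : l.length + 1 ≤ K
        · refine Or.inr ⟨a :: l, v, rfl, by simpa using hlt, ?_, Or.inr h0, ?_⟩
          · simpa [ha] using fun g b h => hl (g, b) h
          · simp only [tot, zeroInd, moveInd, ha, hst, h0, List.length_cons]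
            push_cast
            simp
            linarith
        · exact Or.inl ⟨[a], l, v, rfl, by omega, hl, h0⟩
      · obtain rfl : l = [] := hv.resolve_right h0
        refine Or.inr ⟨[], a :: v, rfl, by simp, by simp, Or.inl rfl, ?_⟩
        simpa [tot, zeroInd, moveInd, ha, h0] using hz
    · refine Or.inr ⟨[], a :: (l ++ v), rfl, by simp, by simp, Or.inl rfl, ?_⟩
      simp only [tot, zeroInd, moveInd, ha]
      simp
      have : (l.length : ℤ) ≤ K := by exact_mod_cast hlK
      linarith

lemma count_loop {l v : Word GenG} (hl : ∀ a ∈ l, isMove a.1 = false) (hv : st v = 0)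
    (hP : AllAt Nice (l ++ v)) :
    cX v ≤ cX (l ++ v) ∧ cY v ≤ cY (l ++ v) ∧
      cX (l ++ v) + cY (l ++ v) = cX v + cY v + l.length ∧
      cX' (l ++ v) = cX' v ∧ cY' (l ++ v) = cY' v ∧
      tot moveInd (l ++ v) = tot moveInd v := by
  induction l with
  | nil => simp
  | cons a l ih =>
    have hl' : ∀ a ∈ l, isMove a.1 = false := fun b hb => hl b (by simp [hb])
    have hst : st (l ++ v) = 0 := by rw [st_append_of_not_move hl', hv]
    obtain ⟨h1, h2, h3, h4, h5, h6⟩ := ih hl' hP.2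
    have ha := hl a (by simp)
    have hN : Nice a (st (l ++ v)) := hP.1
    rw [hst] at hN
    rcases hN with h | ⟨rfl, -⟩ | ⟨rfl, -⟩ | ⟨-, h⟩ | ⟨-, h⟩
    · simp [h] at ha
    · simp only [cX, cY, cX', cY'] at *
      simp [tot, hst, ind, moveInd, isMove]
      omega
    · simp only [cX, cY, cX', cY'] at *
      simp [tot, hst, ind, moveInd, isMove]
      omega
    · exact absurd h (by decide)
    · exact absurd h (by decide)

lemma ind_nonneg (w : Word GenG) : 0 ≤ cX w ∧ 0 ≤ cY w ∧ 0 ≤ cX' w ∧ 0 ≤ cY' w := by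
  have h0 (w : Word GenG) : tot (fun _ _ => 0) w = 0 := by
    induction w with
    | nil => rfl
    | cons a w ih => simpa [tot] using ih
  have (a₀ : GenG × Bool) (σ₀ : St) : 0 ≤ tot (ind a₀ σ₀) w := by
    rw [← h0 w]
    refine tot_le (fun a σ => ?_) w
    unfold ind
    split_ifs <;> simp
  exact ⟨this _ _, this _ _, this _ _, this _ _⟩

/-- Words which lean enough towards `x` or `y` in state `1` can be rewritten so as to avoid one of
the states `t` and `s²`, which saves moves. -/
lemma not_geodesic {w : Word GenG} (hP : AllAt Nice w) (hst : st w = (2, 1))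
    (hm : 3 < tot moveInd w) (h : cY' w ≤ cX w ∨ cX' w ≤ cY w) : ¬ IsGeodesicG w := by
  intro hg
  obtain ⟨h1, h2, h3, h4⟩ := ind_nonneg w
  have hlen := length_eq w
  rw [nice_outInd hP] at hlen
  have he := evalG_of_nice hP
  rw [hst] at he
  rcases h with h | h
  · have e : evalG (wordViaSS (cX w - cY' w).toNat (cY w + cY' w).toNat
        (cX' w + cY' w).toNat) = evalG w := by
      rw [evalG_wordViaSS, he, nf_shift (cY' w) (cX w)]
      congr 2 <;> omega
    have := hg.length_le e
    rw [length_wordViaSS] at this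
    omega
  · have e : evalG (wordViaT (cX w + cX' w).toNat (cY w - cX' w).toNat
        (cY' w + cX' w).toNat) = evalG w := by
      rw [evalG_wordViaT, he, nf_shift (-cX' w) (cX w)]
      congr 2 <;> omega
    have := hg.length_le e
    rw [length_wordViaT] at this
    omega

end NS

open NS in
/-- There is no regular language `L` over the symmetric alphabet
`X = {x^{±1}, y^{±1}, t^{±1}, s^{±1}}` such that every word of `L` is geodesic for `G`
and the evaluation map from `L` to `G` is surjective. -/
theorem no_regular_geodesic_language_surjecting_to_G :
    ¬ ∃ L : Language (GenG × Bool), L.IsRegular ∧ (∀ w ∈ L, IsGeodesicG w) ∧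
      (∀ g : G, ∃ w ∈ L, evalG w = g) := by
  rintro ⟨L, ⟨σ, _, M, rfl⟩, hgeo, hsurj⟩
  obtain ⟨n, hn⟩ : ∃ n, n = 6 * Fintype.card σ + 3 := ⟨_, rfl⟩
  obtain ⟨w, hwL, hw⟩ := hsurj (evalG (wordTarget n))
  have hlen := (hgeo w hwL).length_le hw.symm
  rw [length_wordTarget] at hlen
  obtain ⟨hP, hst, hm, hX, hY, hS⟩ := shape_of_short (by omega) hw hlen
  obtain ⟨u, l, v, rfl, hK, hl, hv⟩ := exists_block (Fintype.card σ) w (by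
    rw [nice_zeroInd hP, hm]
    omega)
  obtain ⟨q, a, b, c, rfl, -, hb, ha, hbq, hcq⟩ :=
    M.evalFrom_split (s := M.evalFrom M.start u) hK rfl
  have hlb : ∀ x ∈ b, isMove x.1 = false := fun x hx => hl x (by simp [hx])
  have hlc : ∀ x ∈ c, isMove x.1 = false := fun x hx => hl x (by simp [hx])
  have hv' : st (c ++ v) = 0 := by rw [st_append_of_not_move hlc, hv]
  have hassoc : u ++ (a ++ b ++ c ++ v) = (u ++ a) ++ (b ++ (c ++ v)) := by simp
  rw [hassoc] at hP hst hm hX hY hS hwL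
  have hloop : st (b ++ (c ++ v)) = st (c ++ v) := st_append_of_not_move hlb _
  have hstp := st_pump hloop (n + 1)
  have hrep := hloop.trans hstp.symm
  have hcount := count_loop hlb hv' hP.right
  have hpos : 1 ≤ b.length := List.length_pos_iff.mpr hb
  obtain ⟨-, -, h3, h4⟩ := ind_nonneg ((u ++ a) ++ (b ++ (c ++ v)))
  have htot (f : GenG × Bool → St → ℤ) : tot f ((u ++ a) ++ pump b (c ++ v) (n + 1)) =
      tot f ((u ++ a) ++ (b ++ (c ++ v))) + n * (tot f (b ++ (c ++ v)) - tot f (c ++ v)) := by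
    have h1 := tot_replace (f := f) (u ++ a) hrep
    have h2 := tot_pump (f := f) hloop (n + 1)
    push_cast at h2
    linarith
  have hmem : (u ++ a) ++ pump b (c ++ v) (n + 1) ∈ M.accepts := by
    rw [DFA.mem_accepts, DFA.eval, DFA.evalFrom_of_append M M.start,
      DFA.evalFrom_of_append M M.start, ha] at hwL ⊢
    rw [DFA.evalFrom_of_append, hbq] at hwL
    rwa [evalFrom_pump M hbq]
  refine not_geodesic (hP.replace (hP.right.pump hloop _) hrep) ?_ ?_ ?_ (hgeo _ hmem)
  · rw [st_append, ← hrep, ← st_append, hst]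
  · rw [htot, hcount.2.2.2.2.2, hm]
    simp
  · obtain ⟨i1, i2, i3, i4, i5, -⟩ := hcount
    simp only [cX, cY, cX', cY', htot] at *
    rw [i4, i5]
    have hi :
        1 ≤ tot (ind (GenG.x, true) 0) (b ++ (c ++ v)) - tot (ind (GenG.x, true) 0) (c ++ v) ∨
        1 ≤ tot (ind (GenG.y, true) 0) (b ++ (c ++ v)) - tot (ind (GenG.y, true) 0) (c ++ v) := by
      omega
    rcases hi with hi | hi
    · left
      have := mul_le_mul_of_nonneg_left hi (Int.natCast_nonneg n)
      linarith
    · right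
      have := mul_le_mul_of_nonneg_left hi (Int.natCast_nonneg n)
      linarith
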